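/- Let M be a finite nonempty metric space with n points. For every k ≥ 1 and every coloring χ : NESurj(Ω, M) → Fin k each of whose color classes is a Borel subset of the product space M^ℕ (M taken discrete, M^ℕ with the product topology), there exists a non-expansive surjection w : Ω → Ω such that the set {χ(f ∘ w) : f ∈ NESurj(Ω, M)} has at most n! elements. (The dual big Ramsey degree of M in Ω with respect to non-expansive surjections and Borel colorings is at most |M|!.) -/

import Mathlib

/-- A non-expansive surjection from `Ω = (ℕ, d_ω)` (where `d_ω(x,y) = max{x,y}`
for `x ≠ y`) onto a metric space `M`. -/
def IsOmegaNESurj {M : Type*} [MetricSpace M] (f : ℕ → M) : Prop :=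
  Function.Surjective f ∧ ∀ x y : ℕ, x ≠ y → dist (f x) (f y) ≤ ((max x y : ℕ) : ℝ)

/-- A non-expansive surjection `Ω → Ω`. -/
def IsOmegaNESurjSelf (w : ℕ → ℕ) : Prop :=
  Function.Surjective w ∧ ∀ x y : ℕ, w x ≠ w y → max (w x) (w y) ≤ max x y

section CarlsonSimpson
open Filter
attribute [local instance] Ultrafilter.mul Ultrafilter.semigroup

/-- A compact right topological semigroup has a minimal closed left ideal with an idempotent `w`
such that `w * e = w` for every idempotent `e` in it. -/
theorem cs_exists_minimal {S : Type*} [Nonempty S] [Semigroup S] [TopologicalSpace S]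
    [CompactSpace S] [T2Space S] (hc : ∀ r : S, Continuous (· * r)) :
    ∃ w : S, w * w = w ∧ ∀ y : S, (y * w) * (y * w) = y * w → w * (y * w) = w := by
  let F : Set (Set S) := {N | IsClosed N ∧ N.Nonempty ∧ ∀ x, ∀ y ∈ N, x * y ∈ N}
  rsuffices ⟨N, hN⟩ : ∃ N', Minimal (· ∈ F) N'
  · obtain ⟨Ncl, Nne, Nid⟩ := hN.prop
    obtain ⟨w, hwN, hw⟩ := exists_idempotent_in_compact_subsemigroup hc N Nne Ncl.isCompact
      (fun x _ y hy => Nid x y hy)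
    refine ⟨w, hw, fun y he => ?_⟩
    set e := y * w with hedef
    have heN : e ∈ N := Nid y w hwN
    have hr : Set.range (· * e) = N := by
      apply hN.eq_of_subset
      · refine ⟨(isCompact_range (hc e)).isClosed, ⟨_, ⟨e, rfl⟩⟩, ?_⟩
        rintro x _ ⟨z, rfl⟩
        exact ⟨x * z, mul_assoc _ _ _⟩
      · rintro _ ⟨z, rfl⟩
        exact Nid z e heN
    rw [← hr] at hwN
    obtain ⟨z, hz⟩ := hwN
    simp only at hz
    rw [← hz, mul_assoc, he]
  refine zorn_superset _ fun c hcs hch => ?_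
  refine ⟨⋂₀ c, ⟨isClosed_sInter fun t ht => (hcs ht).1, ?_, fun x y hy => ?_⟩, fun s hs =>
      Set.sInter_subset_of_mem hs⟩
  · obtain rfl | hcnemp := c.eq_empty_or_nonempty
    · rw [Set.sInter_empty]
      apply Set.univ_nonempty
    convert!
      @IsCompact.nonempty_iInter_of_directed_nonempty_isCompact_isClosed _ _ _ hcnemp.coe_sort
        ((↑) : c → Set S) ?_ ?_ ?_ ?_
    · exact Set.sInter_eq_iInter
    · refine DirectedOn.directed_val (IsChain.directedOn hch.symm)
    exacts [fun i => (hcs i.prop).2.1, fun i => (hcs i.prop).1.isCompact, fun i => (hcs i.prop).1]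
  · rw [Set.mem_sInter]
    exact fun t ht => (hcs ht).2.2 x y (Set.mem_sInter.mp hy t ht)

theorem cs_map_mul {G H : Type*} [Semigroup G] [Semigroup H] (φ : G → H)
    (hφ : ∀ x y, φ (x * y) = φ x * φ y) (U V : Ultrafilter G) :
    Ultrafilter.map φ (U * V) = Ultrafilter.map φ U * Ultrafilter.map φ V := by
  apply Ultrafilter.coe_inj.mp
  apply Filter.ext'
  intro p
  rw [Ultrafilter.eventually_mul]
  simp only [Ultrafilter.coe_map, Filter.eventually_map]
  rw [Ultrafilter.eventually_mul]
  simp only [hφ]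

/-- substitution of a letter for the variable `none` -/
def csSub {A : Type} (a : A) (v : FreeMonoid (Option A)) : FreeMonoid A :=
  FreeMonoid.map (fun o => o.getD a) v

theorem csSub_mul {A : Type} (a : A) (v v' : FreeMonoid (Option A)) :
    csSub a (v * v') = csSub a v * csSub a v' := by
  simp [csSub]

/-- left variable words -/
def csLV (A : Type) : Set (FreeMonoid (Option A)) :=
  {v | ∃ u : FreeMonoid (Option A), v = FreeMonoid.of none * u}

theorem cs_ultra (A : Type) : ∃ (w : Ultrafilter (FreeMonoid A))
    (V : Ultrafilter (FreeMonoid (Option A))),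
    (∀ᶠ v in V, v ∈ csLV A) ∧ (∀ a, w * Ultrafilter.map (csSub a) V = w) ∧
    (∀ a b, Ultrafilter.map (csSub a) V * Ultrafilter.map (csSub b) V
      = Ultrafilter.map (csSub a) V) := by
  obtain ⟨w, hw, hmin⟩ := cs_exists_minimal (S := Ultrafilter (FreeMonoid A))
    Ultrafilter.continuous_mul_left
  let ι : FreeMonoid A → FreeMonoid (Option A) := fun x => FreeMonoid.map some x
  have hι : ∀ x y, ι (x * y) = ι x * ι y := fun x y => by simp [ι]
  have hsub : ∀ a x, csSub a (ι x) = x := fun a x => by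
    simp only [csSub, ι]
    rw [FreeMonoid.map_map]
    have : ((fun o : Option A => o.getD a) ∘ some) = id := by ext; simp
    rw [this]; simp
  set W := Ultrafilter.map ι w with hW
  have hmapW : ∀ a, Ultrafilter.map (csSub a) W = w := fun a => by
    rw [hW, Ultrafilter.map_map]
    have : csSub a ∘ ι = id := by ext1 x; exact hsub a x
    rw [this, Ultrafilter.map_id]
  let T : Set (Ultrafilter (FreeMonoid (Option A))) := {t | csLV A ∈ t}
  have hTr : ∀ t ∈ T, ∀ s, t * s ∈ T := by
    intro t ht s
    change ∀ᶠ m in ((t * s : Ultrafilter _) : Filter _), m ∈ csLV A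
    rw [Ultrafilter.eventually_mul]
    have ht' : ∀ᶠ m in (t : Filter _), m ∈ csLV A := ht
    filter_upwards [ht'] with m hm
    refine Filter.Eventually.of_forall fun m' => ?_
    obtain ⟨u, rfl⟩ := hm
    exact ⟨u * m', mul_assoc _ _ _⟩
  have hTc : IsCompact T := (ultrafilter_isClosed_basic _).isCompact
  obtain ⟨V, ⟨t, ht, rfl⟩, hV⟩ := exists_idempotent_in_compact_subsemigroup
    (Ultrafilter.continuous_mul_left (M := FreeMonoid (Option A))) ((· * W) '' T)
    (by
      refine Set.Nonempty.image _ ⟨pure (FreeMonoid.of none), ?_⟩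
      exact ⟨1, by simp⟩)
    (hTc.image (Ultrafilter.continuous_mul_left W))
    (by
      rintro _ ⟨t, ht, rfl⟩ _ ⟨t', ht', rfl⟩
      refine ⟨t * W * t', hTr _ (hTr _ ht _) _, ?_⟩
      simp only [mul_assoc])
  simp only at hV
  have he : ∀ a, Ultrafilter.map (csSub a) (t * W) = Ultrafilter.map (csSub a) t * w := fun a => by
    rw [cs_map_mul _ (csSub_mul a), hmapW]
  have hidem : ∀ a, Ultrafilter.map (csSub a) (t * W) * Ultrafilter.map (csSub a) (t * W)
      = Ultrafilter.map (csSub a) (t * W) := fun a => by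
    rw [← cs_map_mul _ (csSub_mul a), hV]
  have hwe : ∀ a, w * Ultrafilter.map (csSub a) (t * W) = w := fun a => by
    have := hidem a
    rw [he] at this ⊢
    exact hmin _ this
  refine ⟨w, t * W, hTr _ ht _, hwe, fun a b => ?_⟩
  calc _ = Ultrafilter.map (csSub a) t * (w * Ultrafilter.map (csSub b) (t * W)) := by
        rw [he a, mul_assoc]
    _ = _ := by rw [hwe, he]

theorem cs_words (A K : Type) [Finite A] [Finite K] (κ : FreeMonoid A → K) :
    ∃ (k : K) (G : Set (FreeMonoid A)), G.Nonempty ∧ (∀ t ∈ G, κ t = k) ∧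
      ∀ F : Set (FreeMonoid A), F.Finite → F ⊆ G →
        ∃ v ∈ csLV A, ∀ t ∈ F, ∀ a, t * csSub a v ∈ G := by
  obtain ⟨w, V, hLV, hwe, hee⟩ := cs_ultra A
  obtain ⟨k, hk⟩ : ∃ k, ∀ᶠ t in (w : Filter _), κ t = k := by
    have : ∀ᶠ t in (w : Filter _), ∃ k ∈ (Set.univ : Set K), κ t = k :=
      Filter.Eventually.of_forall fun t => ⟨_, trivial, rfl⟩
    rw [Ultrafilter.eventually_exists_mem_iff Set.finite_univ] at this
    simpa using this
  let G : Set (FreeMonoid A) := {t | κ t = k ∧ ∀ a, ∀ᶠ v in (V : Filter _), κ (t * csSub a v) = k}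
  have key : ∀ (U : Ultrafilter (FreeMonoid A)) (a : A) (p : FreeMonoid A → Prop),
      (∀ᶠ t in ((U * Ultrafilter.map (csSub a) V : Ultrafilter _) : Filter _), p t) →
      ∀ᶠ t in (U : Filter _), ∀ᶠ v in (V : Filter _), p (t * csSub a v) := by
    intro U a p h
    rw [Ultrafilter.eventually_mul] at h
    simpa using h
  refine ⟨k, G, ?_, fun t ht => ht.1, ?_⟩
  · have h1 : ∀ a, ∀ᶠ t in (w : Filter _), ∀ᶠ v in (V : Filter _), κ (t * csSub a v) = k := by
      intro a
      refine key w a (fun t => κ t = k) ?_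
      rw [hwe]; exact hk
    exact (hk.and (eventually_all.2 h1)).exists
  · intro F hF hFG
    have h2 : ∀ t ∈ F, ∀ a, ∀ᶠ v in (V : Filter _), t * csSub a v ∈ G := by
      intro t ht a
      have hG := hFG ht
      refine (hG.2 a).and (eventually_all.2 fun b => ?_)
      have h3 : ∀ᶠ s in ((Ultrafilter.map (csSub a) V *
          Ultrafilter.map (csSub b) V : Ultrafilter _) : Filter _), κ (t * s) = k := by
        rw [hee]
        simpa using hG.2 a
      have h4 := key _ b _ h3
      simpa [mul_assoc] using h4
    have h5 : ∀ᶠ v in (V : Filter _), ∀ t ∈ F, ∀ a, t * csSub a v ∈ G :=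
      (hF.eventually_all).2 fun t ht => eventually_all.2 fun a => h2 t ht a
    obtain ⟨v, hv1, hv2⟩ := (hLV.and h5).exists
    exact ⟨v, hv1, hv2⟩

/-- the word obtained from `t0` and the first `r` left variable words -/
def csWord {A : Type} (t0 : List A) (v : ℕ → List (Option A)) (a : ℕ → A) : ℕ → List A
  | 0 => t0
  | r + 1 => csWord t0 v a r ++ a r :: (v r).map (fun o => o.getD (a r))

theorem carlson_simpson (A K : Type) [Finite A] [Finite K] (κ : List A → K) :
    ∃ (k : K) (t0 : List A) (v : ℕ → List (Option A)),
      ∀ a r, κ (csWord t0 v a r) = k := by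
  obtain ⟨k, G, ⟨t0, ht0⟩, hGk, hstep⟩ := cs_words A K κ
  have hstep' : ∀ F : {F : Set (FreeMonoid A) // F.Finite ∧ F ⊆ G},
      ∃ u : List (Option A), ∀ t ∈ F.1, ∀ a : A,
        t * (FreeMonoid.ofList (a :: u.map (fun o => o.getD a))) ∈ G := by
    rintro ⟨F, hF, hFG⟩
    obtain ⟨v, ⟨u, rfl⟩, hv⟩ := hstep F hF hFG
    exact ⟨FreeMonoid.toList u, hv⟩
  choose u hu using hstep'
  let nxt : {F : Set (FreeMonoid A) // F.Finite ∧ F ⊆ G} →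
      {F : Set (FreeMonoid A) // F.Finite ∧ F ⊆ G} := fun F =>
    ⟨⋃ a : A, (fun t => t * (FreeMonoid.ofList (a :: (u F).map (fun o => o.getD a)))) '' F.1,
      Set.finite_iUnion fun a => F.2.1.image _,
      Set.iUnion_subset fun a => by
        rintro _ ⟨t, ht, rfl⟩
        exact hu F t ht a⟩
  let Fs : ℕ → {F : Set (FreeMonoid A) // F.Finite ∧ F ⊆ G} := fun r =>
    nxt^[r] ⟨{t0}, Set.finite_singleton _, by simpa using ht0⟩
  have hFs : ∀ r, Fs (r+1) = nxt (Fs r) := fun r => Function.iterate_succ_apply' _ _ _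
  refine ⟨k, t0, fun r => u (Fs r), fun a r => hGk _ ((Fs r).2.2 ?_)⟩
  induction r with
  | zero => exact Set.mem_singleton _
  | succ r ih =>
    rw [hFs]
    exact Set.mem_iUnion.2 ⟨a r, _, ih, rfl⟩
end CarlsonSimpson

/-- first occurrences happen in increasing order -/
def Rig (f : ℕ → ℕ) : Prop := ∀ x, ∀ j < f x, ∃ y < x, f y = j

theorem Rig.le {f : ℕ → ℕ} (h : Rig f) : ∀ x, f x ≤ x := by
  intro x
  induction x using Nat.strong_induction_on with
  | _ x ih =>
    by_contra hlt
    obtain ⟨y, hy, hfy⟩ := h x (f x - 1) (by omega)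
    have := ih y hy
    omega

theorem Rig.comp {f w : ℕ → ℕ} (hf : Rig f) (hw : Rig w) : Rig (f ∘ w) := by
  intro x j hj
  obtain ⟨y, hy, hfy⟩ := hf (w x) j hj
  obtain ⟨z, hz, hwz⟩ := hw x y hy
  exact ⟨z, hz, by simp [hwz, hfy]⟩

def RS (d : ℕ) (w : ℕ → ℕ) : Prop := Rig w ∧ Function.Surjective w ∧ ∀ i < d, w i = i

def SS (n d : ℕ) (f : ℕ → Fin n) : Prop :=
  Rig (fun i => (f i : ℕ)) ∧ Function.Surjective f ∧ ∀ i < d, (f i : ℕ) = i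

theorem RS.mono {d e : ℕ} (h : d ≤ e) {w} (hw : RS e w) : RS d w :=
  ⟨hw.1, hw.2.1, fun i hi => hw.2.2 i (by omega)⟩

theorem RS.comp {d : ℕ} {w u} (hw : RS d w) (hu : RS d u) : RS d (w ∘ u) :=
  ⟨hw.1.comp hu.1, hw.2.1.comp hu.2.1, fun i hi => by
    simp [hu.2.2 i hi, hw.2.2 i hi]⟩

theorem RS.id (d : ℕ) : RS d id :=
  ⟨fun _ j hj => ⟨j, hj, rfl⟩, Function.surjective_id, fun _ _ => rfl⟩

theorem SS.comp {n d : ℕ} {f : ℕ → Fin n} {w} (hf : SS n d f) (hw : RS d w) : SS n d (f ∘ w) :=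
  ⟨Rig.comp hf.1 hw.1, hf.2.1.comp hw.2.1, fun i hi => by
    simp [hw.2.2 i hi, hf.2.2 i hi]⟩

/-- the coloring statement -/
def QQ (n d : ℕ) : Prop := ∀ (K : Type) [Finite K] (c : (ℕ → Fin n) → K),
  (∀ k, MeasurableSet (c ⁻¹' {k})) → ∃ w, RS d w ∧ ∃ k, ∀ f, SS n d f → c (f ∘ w) = k

/-! ### Baire category base case -/

theorem exists_cyl {n : ℕ} {U : Set (ℕ → Fin n)} (hU : IsOpen U) {x} (hx : x ∈ U) :
    ∃ l, ∀ f : ℕ → Fin n, (∀ i < l, f i = x i) → f ∈ U := by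
  obtain ⟨v, ⟨y, l, rfl⟩, hxv, hv⟩ :=
    (PiNat.isTopologicalBasis_cylinders (fun _ : ℕ => Fin n)).exists_subset_of_mem_open hx hU
  refine ⟨l, fun f hf => hv ?_⟩
  intro i hi
  rw [hf i hi]; exact hxv i hi

theorem block_aux {n : ℕ} {U : Set (ℕ → Fin n)} (hU : IsOpen U) (hd : Dense U) (k : ℕ)
    (z0 : ℕ → Fin n) (P : Finset (Fin k → Fin n)) :
    ∃ k' > k, ∃ z : ℕ → Fin n, ∀ f : ℕ → Fin n, (fun i : Fin k => f i) ∈ P →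
      (∀ i, k ≤ i → i < k' → f i = z i) → f ∈ U := by
  classical
  induction P using Finset.induction_on with
  | empty => exact ⟨k+1, by omega, z0, fun f hf => by simp at hf⟩
  | insert p P hp ih =>
    obtain ⟨k', hk', z, hz⟩ := ih
    let g : ℕ → Fin n := fun i => if h : i < k then p ⟨i, h⟩ else z i
    obtain ⟨g', hg'c, hg'U⟩ := hd.inter_open_nonempty _
      (PiNat.isOpen_cylinder (fun _ : ℕ => Fin n) g k') ⟨g, PiNat.self_mem_cylinder _ _⟩
    obtain ⟨l, hl⟩ := exists_cyl hU hg'U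
    have hg' : ∀ i < k', g' i = g i := fun i hi => hg'c i hi
    refine ⟨max k' l, by omega, g', fun f hf hfg => ?_⟩
    rcases Finset.mem_insert.1 hf with h | h
    · apply hl
      intro i hi
      by_cases hik : i < k
      · rw [hg' i (by omega)]
        have := congrFun h ⟨i, hik⟩
        simp only at this
        simp [g, hik, this]
      · exact hfg i (by omega) (by omega)
    · apply hz f h
      intro i hi hi'
      rw [hfg i hi (by omega), hg' i hi']
      simp [g, show ¬ i < k by omega]

theorem block {n : ℕ} {U : Set (ℕ → Fin n)} (hU : IsOpen U) (hd : Dense U) (k : ℕ)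
    (z0 : ℕ → Fin n) :
    ∃ k' > k, ∃ z : ℕ → Fin n, ∀ f : ℕ → Fin n,
      (∀ i, k ≤ i → i < k' → f i = z i) → f ∈ U := by
  obtain ⟨k', hk', z, hz⟩ := block_aux hU hd k z0 Finset.univ
  exact ⟨k', hk', z, fun f => hz f (Finset.mem_univ _)⟩

theorem blocks {n : ℕ} (U : ℕ → Set (ℕ → Fin n)) (hU : ∀ m, IsOpen (U m)) (hd : ∀ m, Dense (U m))
    (l : ℕ) (z0 : ℕ → Fin n) :
    ∃ (k : ℕ → ℕ) (z : ℕ → Fin n), k 0 = l ∧ StrictMono k ∧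
      ∀ m (f : ℕ → Fin n), (∀ i, k m < i → i < k (m+1) → f i = z i) → f ∈ U m := by
  have H : ∀ m k, ∃ k' > k + 1, ∃ z : ℕ → Fin n, ∀ f : ℕ → Fin n,
      (∀ i, k + 1 ≤ i → i < k' → f i = z i) → f ∈ U m := fun m k => block (hU m) (hd m) (k+1) z0
  choose N hN Z hZ using H
  obtain ⟨k, hk0, hk⟩ : ∃ k : ℕ → ℕ, k 0 = l ∧ ∀ m, k (m+1) = N m (k m) :=
    ⟨fun m => Nat.rec l (fun m k => N m k) m, rfl, fun m => rfl⟩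
  have hmono : StrictMono k := strictMono_nat_of_lt_succ fun m => by
    rw [hk]; have := hN m (k m); omega
  have huniq : ∀ i m m', k m < i → i < k (m+1) → k m' < i → i < k (m'+1) → m = m' := by
    intro i m m' h1 h2 h3 h4
    have := hmono.lt_iff_lt.1 (h1.trans h4)
    have := hmono.lt_iff_lt.1 (h3.trans h2)
    omega
  classical
  let z : ℕ → Fin n := fun i =>
    if h : ∃ m, k m < i ∧ i < k (m+1) then Z h.choose (k h.choose) i else z0 i
  refine ⟨k, z, hk0, hmono, fun m f hf => hZ m (k m) f fun i hi hi' => ?_⟩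
  rw [hf i hi (by rw [hk]; exact hi')]
  have h : ∃ m, k m < i ∧ i < k (m+1) := ⟨m, hi, by rw [hk]; exact hi'⟩
  have : h.choose = m := huniq i _ _ h.choose_spec.1 h.choose_spec.2 hi (by rw [hk]; exact hi')
  simp only [z, dif_pos h, this]

theorem QQ_base (n : ℕ) (hn : 1 ≤ n) : QQ n n := by
  intro K _ c hc
  have : Nonempty (Fin n) := ⟨⟨0, hn⟩⟩
  let ι : (ℕ → Fin n) → (ℕ → Fin n) := fun g i => if h : i < n then ⟨i, h⟩ else g (i - n)
  have hι : Continuous ι := by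
    refine continuous_pi fun i => ?_
    by_cases h : i < n
    · simp only [ι, h, dif_pos]; exact continuous_const
    · simp only [ι, h, dif_neg, not_false_eq_true]; exact continuous_apply _
  have hopen : ∀ k, ∃ u : Set (ℕ → Fin n), IsOpen u ∧
      ∀ᶠ x in residual (ℕ → Fin n), (c (ι x) = k ↔ x ∈ u) := by
    intro k
    obtain ⟨u, hu, hue⟩ := ((hc k).preimage hι.measurable).residualEq_isOpen
    exact ⟨u, hu, hue.mem_iff⟩
  choose u hu hres using hopen
  have hres' : ∀ᶠ x in residual (ℕ → Fin n), ∀ k, (c (ι x) = k ↔ x ∈ u k) :=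
    Filter.eventually_all.2 hres
  obtain ⟨x0, hx0⟩ := (dense_of_mem_residual hres').nonempty
  obtain ⟨l, hl⟩ := exists_cyl (hu _) ((hx0 _).1 rfl)
  obtain ⟨S, hSo, hSd, hSc, hS⟩ := mem_residual_iff.1 hres'
  obtain ⟨U, hU⟩ : ∃ U : ℕ → Set (ℕ → Fin n), insert Set.univ S = Set.range U :=
    (hSc.insert _).exists_eq_range (Set.insert_nonempty _ _)
  have hUo : ∀ m, IsOpen (U m) := fun m => by
    have : U m ∈ insert Set.univ S := hU ▸ Set.mem_range_self m
    rcases this with h | h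
    · rw [h]; exact isOpen_univ
    · exact hSo _ h
  have hUd : ∀ m, Dense (U m) := fun m => by
    have : U m ∈ insert Set.univ S := hU ▸ Set.mem_range_self m
    rcases this with h | h
    · rw [h]; exact dense_univ
    · exact hSd _ h
  obtain ⟨k, z, hk0, hkm, hkU⟩ := blocks U hUo hUd l x0
  classical
  let W : ℕ → ℕ := fun i => if i < l then (x0 i : ℕ) else if h : ∃ m, i = k m then n + h.choose
    else z i
  let w : ℕ → ℕ := fun i => if i < n then i else W (i - n)
  have hlk : ∀ m, l ≤ k m := fun m => hk0 ▸ hkm.monotone (Nat.zero_le m)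
  have hWk : ∀ m, W (k m) = n + m := by
    intro m
    have h : ∃ m', k m = k m' := ⟨m, rfl⟩
    have h' : h.choose = m := (hkm.injective h.choose_spec).symm
    have := hlk m
    simp only [W, if_neg (show ¬ k m < l by omega), dif_pos h, h']
  have hw1 : ∀ i < n, w i = i := fun i hi => by simp [w, hi]
  have hwk : ∀ m, w (n + k m) = n + m := fun m => by simp [w, hWk]
  have hW : ∀ i, W i < n ∨ ∃ m, i = k m := by
    intro i
    by_cases h1 : i < l
    · left; simp [W, h1]
    · by_cases h2 : ∃ m, i = k m
      · exact Or.inr h2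
      · left; simp [W, h1, h2]
  refine ⟨w, ⟨?_, ?_, hw1⟩, c (ι x0), ?_⟩
  · intro x j hj
    by_cases hx : x < n
    · rw [hw1 x hx] at hj
      exact ⟨j, hj, hw1 j (by omega)⟩
    · have hwx : w x = W (x - n) := by simp [w, hx]
      rw [hwx] at hj
      by_cases hjn : j < n
      · exact ⟨j, by omega, hw1 j hjn⟩
      · rcases hW (x - n) with h | ⟨m, hm⟩
        · omega
        · rw [hm, hWk] at hj
          have := hkm (show j - n < m by omega)
          refine ⟨n + k (j - n), by omega, ?_⟩
          rw [hwk]; omega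
  · intro j
    by_cases hj : j < n
    · exact ⟨j, hw1 j hj⟩
    · exact ⟨n + k (j - n), by rw [hwk]; omega⟩
  · intro f hf
    let g : ℕ → Fin n := fun i => f (W i)
    have hfw : f ∘ w = ι g := by
      ext i
      by_cases h : i < n
      · simp [ι, h, w, hf.2.2 i h]
      · simp [ι, h, w, g]
    have hfn : ∀ y : Fin n, f y = y := fun y => Fin.ext (hf.2.2 _ y.2)
    have hgl : ∀ i < l, g i = x0 i := fun i hi => by
      simp [g, W, hi, hfn]
    have hgz : ∀ m i, k m < i → i < k (m+1) → g i = z i := by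
      intro m i h1 h2
      have := hlk m
      have h3 : ¬ ∃ m', i = k m' := by
        rintro ⟨m', rfl⟩
        have := hkm.lt_iff_lt.1 h1
        have := hkm.lt_iff_lt.1 h2
        omega
      simp only [g, W, if_neg (show ¬ i < l by omega), dif_neg h3, hfn]
    have hgU : ∀ m, g ∈ U m := fun m => hkU m g (hgz m)
    have hgS : g ∈ ⋂₀ S := by
      intro s hs
      have : s ∈ Set.range U := hU ▸ Set.mem_insert_of_mem _ hs
      obtain ⟨m, rfl⟩ := this
      exact hgU m
    rw [hfw]
    exact (hS hgS _).2 (hl g hgl)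

/-! ### Fusion -/

/-- iterated composition -/
def GG (u : ℕ → ℕ → ℕ) : ℕ → ℕ → ℕ
  | 0 => id
  | s + 1 => u s ∘ GG u s

theorem GG_RS {e : ℕ} {u : ℕ → ℕ → ℕ} (hu : ∀ r, RS (e + r) (u r)) : ∀ s, RS e (GG u s)
  | 0 => RS.id e
  | s + 1 => ((hu s).mono (by omega)).comp (GG_RS hu s)

theorem GG_stable {e : ℕ} {u : ℕ → ℕ → ℕ} (hu : ∀ r, RS (e + r) (u r)) {s i j : ℕ}
    (h : GG u s i = j) (hj : j < e + s) : ∀ s' ≥ s, GG u s' i = j := by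
  intro s' hs'
  induction s', hs' using Nat.le_induction with
  | base => exact h
  | succ s' hs' ih =>
    simp only [GG, Function.comp_apply, ih]
    exact (hu s').2.2 j (by omega)

theorem GG_stable' {e : ℕ} (he : 1 ≤ e) {u : ℕ → ℕ → ℕ} (hu : ∀ r, RS (e + r) (u r)) {s i : ℕ}
    (h : i ≤ s) : GG u s i = GG u i i := by
  refine GG_stable hu rfl ?_ s h
  have := (GG_RS hu i).1.le i
  omega

theorem GG_lim {e : ℕ} (he : 1 ≤ e) {u : ℕ → ℕ → ℕ} (hu : ∀ r, RS (e + r) (u r)) :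
    RS e (fun i => GG u i i) := by
  refine ⟨?_, ?_, ?_⟩
  · intro x j hj
    obtain ⟨y, hy, hyj⟩ := (GG_RS hu x).1 x j hj
    exact ⟨y, hy, by rw [← hyj]; exact (GG_stable' he hu hy.le).symm⟩
  · intro j
    obtain ⟨i, hi⟩ := (GG_RS hu j).2.1 j
    refine ⟨i, ?_⟩
    simp only
    rw [← GG_stable' he hu (le_max_left i j)]
    exact GG_stable hu hi (by omega) _ (le_max_right i j)
  · intro i hi
    exact (GG_RS hu i).2.2 i hi

theorem GG_add (u : ℕ → ℕ → ℕ) (m : ℕ) : ∀ s i,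
    GG u (m + s) i = GG (fun r => u (m + r)) s (GG u m i)
  | 0, _ => rfl
  | s + 1, i => by
    have := GG_add u m s i
    change u (m + s) (GG u (m + s) i) = u (m + s) (GG (fun r => u (m + r)) s (GG u m i))
    rw [this]

theorem fusion (d : ℕ) (P : ℕ → (ℕ → ℕ) → Prop)
    (hst : ∀ r w U, RS d w → RS (d + r + 1) U → P r w → P r (U ∘ w))
    (hstep : ∀ r w, RS d w → ∃ u, RS (d + r + 1) u ∧ P r (u ∘ w)) :
    ∃ w, RS d w ∧ ∀ r, P r w := by
  have hstep' : ∀ r (w : {w // RS d w}), ∃ u, RS (d + r + 1) u ∧ P r (u ∘ w.1) :=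
    fun r w => hstep r w.1 w.2
  choose u hu hP using hstep'
  let ws : ℕ → {w // RS d w} := fun r => Nat.rec ⟨id, RS.id d⟩
    (fun r w => ⟨u r w ∘ w.1, ((hu r w).mono (by omega)).comp w.2⟩) r
  let v : ℕ → ℕ → ℕ := fun r => u r (ws r)
  have hv : ∀ r, RS (d + 1 + r) (v r) := fun r => by
    have := hu r (ws r)
    rwa [show d + r + 1 = d + 1 + r by omega] at this
  have hws : ∀ r, (ws r).1 = GG v r := by
    intro r
    induction r with
    | zero => rfl
    | succ r ih => rw [GG, ← ih]
  refine ⟨fun i => GG v i i, (GG_lim (by omega) hv).mono (by omega), fun r => ?_⟩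
  have hv' : ∀ s, RS (d + r + 2 + s) (v (r + 1 + s)) := fun s => by
    have := hv (r + 1 + s)
    rwa [show d + 1 + (r + 1 + s) = d + r + 2 + s by omega] at this
  have h1 : P r (GG v (r + 1)) := by
    have := hP r (ws r)
    rw [hws r] at this
    exact this
  have h2 := hst r _ _ ((GG_RS hv (r+1)).mono (by omega))
    ((GG_lim (by omega) hv').mono (by omega)) h1
  convert h2 using 1
  ext i
  simp only [Function.comp_apply]
  rw [← GG_stable' (by omega) hv (show i ≤ r + 1 + i by omega), GG_add]
  exact GG_stable' (by omega) hv' ((GG_RS hv (r+1)).1.le i)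

/-! ### The inductive step -/

theorem lift_step {n d : ℕ} (hQ : QQ n (d + 1)) (hd : 1 ≤ d) {K : Type} [Finite K]
    (c : (ℕ → Fin n) → K) (hc : ∀ k, MeasurableSet (c ⁻¹' {k})) (m : ℕ) (hm : d ≤ m)
    (w : ℕ → ℕ) : ∃ u, RS (m + 1) u ∧ ∀ f f' : ℕ → Fin n, SS n d f → SS n d f' →
      (∀ i < m, f i = f' i) → (∀ i < m, (f i : ℕ) < d) → (f m : ℕ) = d → (f' m : ℕ) = d →
      c (f ∘ u ∘ w) = c (f' ∘ u ∘ w) := by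
  let π : (Fin m → Fin d) → ℕ → ℕ := fun t i => if h : i < m then t ⟨i, h⟩ else i - m + d
  let c' : (ℕ → Fin n) → ((Fin m → Fin d) → K) := fun f t => c (f ∘ π t ∘ w)
  have hc' : ∀ k, MeasurableSet (c' ⁻¹' {k}) := by
    intro k
    have : c' ⁻¹' {k} = ⋂ t, (fun f : ℕ → Fin n => f ∘ π t ∘ w) ⁻¹' (c ⁻¹' {k t}) := by
      ext f
      simp [c', funext_iff]
    rw [this]
    refine MeasurableSet.iInter fun t => (hc _).preimage ?_
    exact measurable_pi_iff.2 fun i => measurable_pi_apply _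
  obtain ⟨u', hu', k, hk⟩ := hQ _ c' hc'
  let u : ℕ → ℕ := fun i => if i < m then i else
    if u' (i - m + d) < d then u' (i - m + d) else u' (i - m + d) - d + m
  have hum : ∀ i < m + 1, u i = i := by
    intro i hi
    by_cases h : i < m
    · simp [u, h]
    · have : i = m := by omega
      subst this
      simp [u, hu'.2.2 d (by omega)]
  have hRS : RS (m + 1) u := by
    refine ⟨?_, ?_, hum⟩
    · intro x j hj
      by_cases hx : x < m
      · rw [hum x (by omega)] at hj
        exact ⟨j, hj, hum j (by omega)⟩
      · by_cases hjm : j < m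
        · exact ⟨j, by omega, hum j (by omega)⟩
        · have hux : u x = if u' (x - m + d) < d then u' (x - m + d) else
              u' (x - m + d) - d + m := by simp [u, hx]
          rw [hux] at hj
          split_ifs at hj with h
          · omega
          · obtain ⟨y, hy, hyj⟩ := hu'.1 (x - m + d) (j - m + d) (by omega)
            have hyd : d ≤ y := by
              have := hu'.1.le y
              omega
            refine ⟨y - d + m, by omega, ?_⟩
            simp only [u, if_neg (show ¬ (y - d + m < m) by omega),
              show y - d + m - m + d = y by omega, hyj]
            rw [if_neg (by omega)]; omega
    · intro j
      by_cases hjm : j < m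
      · exact ⟨j, hum j (by omega)⟩
      · obtain ⟨y, hyj⟩ := hu'.2.1 (j - m + d)
        have hyd : d ≤ y := by
          have := hu'.1.le y
          omega
        refine ⟨y - d + m, ?_⟩
        simp only [u, if_neg (show ¬ (y - d + m < m) by omega),
          show y - d + m - m + d = y by omega, hyj]
        rw [if_neg (by omega)]; omega
  have key : ∀ (f : ℕ → Fin n) (t : Fin m → Fin d), SS n d f → (∀ i : Fin m, (f i : ℕ) = t i) →
      (f m : ℕ) = d → c (f ∘ u ∘ w) = k t := by
    intro f t hf hft hfm
    have htd : ∀ i (hi : i < d), (t ⟨i, by omega⟩ : ℕ) = i := fun i hi => by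
      rw [← hft]; exact hf.2.2 i hi
    let f' : ℕ → Fin n := fun i => if i < d then f i else f (i - d + m)
    have hf'd : ∀ i < d, (f' i : ℕ) = i := fun i hi => by
      simp [f', hi, hf.2.2 i hi]
    have hlt : ∀ i < m, (f i : ℕ) < d := fun i hi => by
      rw [hft ⟨i, hi⟩]; exact (t _).2
    have hf' : SS n (d + 1) f' := by
      refine ⟨?_, ?_, ?_⟩
      · intro x j hj
        simp only at hj ⊢
        by_cases hx : x < d
        · rw [hf'd x hx] at hj
          exact ⟨j, hj, hf'd j (by omega)⟩
        · by_cases hjd : j < d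
          · exact ⟨j, by omega, hf'd j hjd⟩
          · simp only [f', if_neg hx] at hj
            obtain ⟨y, hy, hyj⟩ := hf.1 (x - d + m) j hj
            simp only at hyj
            have hym : m ≤ y := by
              by_contra h
              have := hlt y (by omega)
              omega
            refine ⟨y - m + d, by omega, ?_⟩
            simp [f', show y - m + m = y by omega, hyj]
      · intro j
        by_cases hjd : (j : ℕ) < d
        · exact ⟨j, Fin.ext (hf'd j hjd)⟩
        · obtain ⟨y, hyj⟩ := hf.2.1 j
          have hym : m ≤ y := by
            by_contra h
            have := hlt y (by omega)
            rw [hyj] at this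
            omega
          refine ⟨y - m + d, ?_⟩
          simp [f', show y - m + m = y by omega, hyj]
      · intro i hi
        by_cases h : i < d
        · exact hf'd i h
        · have : i = d := by omega
          subst this
          simp [f', hfm]
    have h1 : f = f' ∘ π t := by
      funext i
      by_cases h : i < m
      · simp only [Function.comp_apply, π, dif_pos h]
        apply Fin.ext
        rw [hf'd _ (t _).2]
        exact hft ⟨i, h⟩
      · simp [π, h, f', show i - m + m = i by omega]
    have h2 : π t ∘ u = u' ∘ π t := by
      funext i
      by_cases h : i < m
      · have hlt' := (t ⟨i, h⟩).2
        simp only [Function.comp_apply, hum i (by omega), π, dif_pos h]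
        exact (hu'.2.2 _ (by omega)).symm
      · simp only [Function.comp_apply, u, if_neg h, π, dif_neg h]
        split_ifs with h1 h2 h3
        · exact htd _ h1
        · omega
        · omega
        · omega
    have h3 : f ∘ u ∘ w = (f' ∘ u') ∘ π t ∘ w := by
      calc f ∘ u ∘ w = f' ∘ (π t ∘ u) ∘ w := by rw [h1]; rfl
        _ = _ := by rw [h2]; rfl
    rw [h3]
    exact congrFun (hk f' hf') t
  refine ⟨u, hRS, fun f f' hf hf' hff hfd hfm hfm' => ?_⟩
  rw [key f (fun i => ⟨f i, hfd i i.2⟩) hf (fun i => rfl) hfm,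
    key f' (fun i => ⟨f i, hfd i i.2⟩) hf' (fun i => by rw [← hff i i.2]) hfm']

theorem QQ_fused {n d : ℕ} (hQ : QQ n (d + 1)) (hd : 1 ≤ d) {K : Type} [Finite K]
    (c : (ℕ → Fin n) → K) (hc : ∀ k, MeasurableSet (c ⁻¹' {k})) :
    ∃ w, RS d w ∧ ∀ m, d ≤ m → ∀ f f' : ℕ → Fin n, SS n d f → SS n d f' →
      (∀ i < m, f i = f' i) → (∀ i < m, (f i : ℕ) < d) → (f m : ℕ) = d → (f' m : ℕ) = d →
      c (f ∘ w) = c (f' ∘ w) := by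
  obtain ⟨w, hw, hP⟩ := fusion d (fun r w => ∀ f f' : ℕ → Fin n, SS n d f → SS n d f' →
      (∀ i < d + r, f i = f' i) → (∀ i < d + r, (f i : ℕ) < d) → (f (d + r) : ℕ) = d →
      (f' (d + r) : ℕ) = d → c (f ∘ w) = c (f' ∘ w))
    (by
      intro r w U hw hU hP f f' hf hf' hff hfd hfm hfm'
      have hUi : ∀ i < d + r + 1, U i = i := hU.2.2
      refine hP (f ∘ U) (f' ∘ U) (hf.comp (hU.mono (by omega))) (hf'.comp (hU.mono (by omega)))
        ?_ ?_ ?_ ?_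
      · intro i hi
        simp [hUi i (by omega), hff i hi]
      · intro i hi
        simp [hUi i (by omega), hfd i hi]
      · simp [hUi (d + r) (by omega), hfm]
      · simp [hUi (d + r) (by omega), hfm'])
    (by
      intro r w hw
      exact lift_step hQ hd c hc (d + r) (by omega) w)
  refine ⟨w, hw, fun m hm => ?_⟩
  have := hP (m - d)
  rwa [show d + (m - d) = m by omega] at this

theorem QQ_step {n d : ℕ} (hQ : QQ n (d + 1)) (hd : 1 ≤ d) (hdn : d < n) : QQ n d := by
  intro K _ c hc
  obtain ⟨w, hw, hwP⟩ := QQ_fused hQ hd c hc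
  let word : (ℕ → Fin n) → ℕ → List ℕ := fun f m => (List.range m).map (fun i => (f i : ℕ))
  let valid : (ℕ → Fin n) → ℕ → Prop := fun f m => SS n d f ∧ d ≤ m ∧ (∀ i < m, (f i : ℕ) < d) ∧
    (f m : ℕ) = d
  obtain ⟨κ, hκ⟩ : ∃ κ : List ℕ → K, ∀ f m, valid f m → κ (word f m) = c (f ∘ w) := by
    classical
    refine ⟨fun l => if h : ∃ f m, valid f m ∧ word f m = l then c (h.choose ∘ w)
      else c (fun _ => ⟨0, by omega⟩), fun f m hfm => ?_⟩
    have h : ∃ f' m', valid f' m' ∧ word f' m' = word f m := ⟨f, m, hfm, rfl⟩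
    simp only [dif_pos h]
    obtain ⟨m', hv, hwd⟩ := h.choose_spec
    generalize h.choose = f' at hv hwd
    have hmm : m' = m := by simpa [word] using congrArg List.length hwd
    subst hmm
    have hff : ∀ i < m', f' i = f i := by
      intro i hi
      have := congrArg (fun l => l[i]?) hwd
      simp [word, hi] at this
      exact Fin.ext this
    exact hwP m' hv.2.1 f' f hv.1 hfm.1 hff hv.2.2.1 hv.2.2.2 hfm.2.2.2
  obtain ⟨k, t0, v, hcs⟩ := carlson_simpson (Fin d) K
    (fun s => κ (List.range d ++ s.map (fun x : Fin d => (x : ℕ))))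
  let p : ℕ → List ℕ := fun r => Nat.rec (List.range d ++ t0.map (fun x : Fin d => (x : ℕ)))
    (fun r l => l ++ (d + r) :: (v r).map (fun o => o.elim (d + r) (fun x : Fin d => (x : ℕ)))) r
  have hp0 : p 0 = List.range d ++ t0.map (fun x : Fin d => (x : ℕ)) := rfl
  have hps : ∀ r, p (r + 1) =
    p r ++ (d + r) :: (v r).map (fun o => o.elim (d + r) (fun x : Fin d => (x : ℕ))) := fun r => rfl
  clear_value p
  have hlen : ∀ r, d + r ≤ (p r).length := by
    intro r
    induction r with
    | zero => simp [hp0]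
    | succ r ih => simp only [hps, List.length_append, List.length_cons]; omega
  have hpre : ∀ r s, r ≤ s → p r <+: p s := by
    intro r s h
    induction s, h using Nat.le_induction with
    | base => exact List.prefix_refl _
    | succ s _ ih => exact ih.trans (by rw [hps]; exact List.prefix_append _ _)
  have hget : ∀ (r s i x : ℕ), r ≤ s → (p r)[i]? = some x → (p s)[i]? = some x := by
    intro r s i x h hx
    obtain ⟨q, hq⟩ := hpre r s h
    rw [← hq, List.getElem?_append_left, hx]
    by_contra hcon
    rw [List.getElem?_eq_none (by omega)] at hx
    simp at hx
  let y : ℕ → ℕ := fun i => ((p (i + 1))[i]?).getD 0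
  have hy : ∀ (r i x : ℕ), (p r)[i]? = some x → y i = x := by
    intro r i x hx
    have h1 := hlen (i + 1)
    have h2 : (p (i+1))[i]? = some ((p (i+1))[i]'(by omega)) := List.getElem?_eq_getElem _
    have h3 := hget _ (max r (i+1)) i _ (le_max_right _ _) h2
    have h4 := hget _ (max r (i+1)) i _ (le_max_left _ _) hx
    rw [h3] at h4
    simp only [y, h2, Option.getD_some]
    exact Option.some.inj h4
  have hyL : ∀ r, y (p r).length = d + r := by
    intro r
    apply hy (r + 1)
    rw [hps]; simp
  have hyd : ∀ i < d, y i = i := by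
    intro i hi
    apply hy 0
    rw [hp0, List.getElem?_append_left (by simpa using hi)]
    simp [hi]
  have hplt : ∀ r, ∀ x ∈ p r, x < d + r := by
    intro r
    induction r with
    | zero =>
      intro x hx
      rw [hp0] at hx
      simp only [List.mem_append, List.mem_range, List.mem_map] at hx
      rcases hx with h | ⟨z, _, rfl⟩
      · omega
      · have := z.2; omega
    | succ r ih =>
      intro x hx
      rw [hps] at hx
      simp only [List.mem_append, List.mem_cons, List.mem_map] at hx
      rcases hx with h | h | ⟨o, _, rfl⟩
      · have := ih x h; omega
      · omega
      · cases o with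
        | none => simp
        | some z => have := z.2; simp; omega
  have hyp : ∀ r, p r = (List.range (p r).length).map y := by
    intro r
    apply List.ext_getElem (by simp)
    intro i h1 h2
    simp only [List.getElem_map, List.getElem_range]
    exact (hy r i _ (List.getElem?_eq_getElem h1)).symm
  have hylt : ∀ r, ∀ x < (p r).length, y x < d + r := by
    intro r x hx
    rw [hy r x _ (List.getElem?_eq_getElem hx)]
    exact hplt r _ (List.getElem_mem hx)
  have hyRS : RS d y := by
    refine ⟨?_, ?_, hyd⟩
    · intro x j hj
      by_cases hjd : j < d
      · refine ⟨j, ?_, hyd j hjd⟩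
        by_cases hx : x < d
        · rwa [hyd x hx] at hj
        · omega
      · refine ⟨(p (j - d)).length, ?_, by rw [hyL]; omega⟩
        by_contra hcon
        rcases Nat.lt_or_ge x (p (j - d)).length with h | h
        · have := hylt _ x h
          omega
        · have : x = (p (j - d)).length := by omega
          rw [this, hyL] at hj
          omega
    · intro j
      by_cases hjd : j < d
      · exact ⟨j, hyd j hjd⟩
      · exact ⟨(p (j - d)).length, by rw [hyL]; omega⟩
  refine ⟨y ∘ w, hyRS.comp hw, k, fun f hf => ?_⟩
  have hex : ∃ m, (f m : ℕ) = d := by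
    obtain ⟨m, hm⟩ := hf.2.1 ⟨d, hdn⟩
    exact ⟨m, by rw [hm]⟩
  obtain ⟨m, hm, hmin⟩ : ∃ m, (f m : ℕ) = d ∧ ∀ i < m, (f i : ℕ) ≠ d := by
    classical
    exact ⟨Nat.find hex, Nat.find_spec hex, fun i hi => Nat.find_min hex hi⟩
  have hlt : ∀ i < m, (f i : ℕ) < d := by
    intro i hi
    by_contra h
    have h1 := hmin i hi
    obtain ⟨z, hz, hzd⟩ := hf.1 i d (by simp only; omega)
    exact hmin z (by omega) hzd
  have hdm : d ≤ m := by
    by_contra h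
    have := hf.2.2 m (by omega)
    omega
  obtain ⟨r, rfl⟩ : ∃ r, m = d + r := ⟨m - d, by omega⟩
  have hvalid : valid (f ∘ y) (p r).length := by
    refine ⟨hf.comp hyRS, ?_, ?_, ?_⟩
    · have := hlen r; omega
    · intro i hi
      exact hlt _ (hylt r i hi)
    · simp only [Function.comp_apply, hyL]; exact hm
  have hval := hκ _ _ hvalid
  change c ((f ∘ y) ∘ w) = k
  rw [← hval]
  have hword : word (f ∘ y) (p r).length = (p r).map (fun i => (f i : ℕ)) := by
    conv_rhs => rw [hyp r]
    simp [word, Function.comp_def]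
  rw [hword]
  let a : ℕ → Fin d := fun i => if h : (f (d + i) : ℕ) < d then ⟨f (d + i), h⟩ else ⟨0, by omega⟩
  have hfd : ∀ x : Fin d, (f x : ℕ) = x := fun x => hf.2.2 _ x.2
  have hmain : ∀ s ≤ r, (p s).map (fun i => (f i : ℕ)) =
      List.range d ++ (csWord t0 v a s).map (fun x : Fin d => (x : ℕ)) := by
    intro s
    induction s with
    | zero =>
      intro _
      rw [hp0, List.map_append]
      congr 1
      · conv_rhs => rw [← List.map_id (List.range d)]
        apply List.map_congr_left
        intro i hi
        exact hf.2.2 i (List.mem_range.1 hi)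
      · simp [csWord, Function.comp_def, hfd]
    | succ s ih =>
      intro hs
      have has : (a s : ℕ) = f (d + s) := by
        have := hlt (d + s) (by omega)
        simp [a, this]
      rw [hps, List.map_append, ih (by omega), csWord, List.map_append, List.append_assoc]
      congr 2
      rw [List.map_cons, List.map_cons, has, List.map_map, List.map_map]
      congr 1
      apply List.map_congr_left
      intro o _
      cases o with
      | none => simp [has]
      | some z => simp [hfd]
  rw [hmain r le_rfl]
  exact hcs a r

theorem QQ_one (n : ℕ) (hn : 1 ≤ n) : QQ n 1 := by
  have : ∀ j, j < n → QQ n (n - j) := by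
    intro j
    induction j with
    | zero => intro _; exact QQ_base n hn
    | succ j ih =>
      intro hj
      have h := ih (by omega)
      rw [show n - j = (n - (j + 1)) + 1 by omega] at h
      exact QQ_step h (by omega) (by omega)
  have h := this (n - 1) (by omega)
  rwa [show n - (n - 1) = 1 by omega] at h

theorem exists_order {M : Type} [Fintype M] {n : ℕ} (hn : Fintype.card M = n) (hn1 : 1 ≤ n)
    (f : ℕ → M) (hf : Function.Surjective f) :
    ∃ (σ : Fin n ≃ M) (r : ℕ → Fin n), SS n 1 r ∧ f = σ ∘ r := by
  classical
  let fst : M → ℕ := fun x => Nat.find (hf x)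
  have hfst : ∀ x, f (fst x) = x := fun x => Nat.find_spec (hf x)
  have hfle : ∀ i, fst (f i) ≤ i := fun i => Nat.find_min' (hf (f i)) rfl
  have hinj : Function.Injective fst := fun x y h => by rw [← hfst x, ← hfst y, h]
  letI : LinearOrder M := LinearOrder.lift' fst hinj
  have hlt : ∀ x y : M, x < y → fst x < fst y := fun x y h => h
  let σ := Fintype.orderIsoFinOfCardEq M hn
  have hrig : Rig (fun i => ((σ.symm (f i) : Fin n) : ℕ)) := by
    intro x j hj
    simp only at hj
    have hjn : j < n := hj.trans (Fin.is_lt _)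
    have h1 : (⟨j, hjn⟩ : Fin n) < σ.symm (f x) := hj
    have h2 : σ ⟨j, hjn⟩ < f x := by
      have := σ.strictMono h1
      simpa using this
    refine ⟨fst (σ ⟨j, hjn⟩), (hlt _ _ h2).trans_le (hfle x), ?_⟩
    simp [hfst]
  refine ⟨σ.toEquiv, fun i => σ.symm (f i), ⟨hrig, ?_, ?_⟩, ?_⟩
  · exact σ.symm.surjective.comp hf
  · intro i hi
    have := hrig.le i
    simp only at this ⊢
    omega
  · funext i
    simp

/-- The dual big Ramsey degree of a finite metric space `M` with `n` points in `Ω`,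
with respect to non-expansive surjections and Borel colorings, is at most `n!`. -/
theorem stmt_6 (M : Type) [MetricSpace M] [Fintype M] [Nonempty M]
    (n : ℕ) (hn : Fintype.card M = n) (k : ℕ) (hk : 1 ≤ k)
    (χ : {f : ℕ → M // IsOmegaNESurj f} → Fin k)
    (hχ : ∀ i : Fin k,
      @MeasurableSet _ (borel (ℕ → M)) (Subtype.val '' (χ ⁻¹' {i}))) :
    ∃ w : ℕ → ℕ, IsOmegaNESurjSelf w ∧
      {c : Fin k | ∃ g : {f : ℕ → M // IsOmegaNESurj f},
          (∃ f : ℕ → M, IsOmegaNESurj f ∧ g.1 = f ∘ w) ∧ χ g = c}.ncard ≤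
        Nat.factorial n := by
  classical
  have hn1 : 1 ≤ n := by rw [← hn]; exact Fintype.card_pos
  let c : (ℕ → Fin n) → ((Fin n ≃ M) → Option (Fin k)) := fun r σ =>
    if h : IsOmegaNESurj (σ ∘ r) then some (χ ⟨_, h⟩) else none
  have hsome : ∀ (σ : Fin n ≃ M) (i : Fin k), MeasurableSet {r | c r σ = some i} := by
    intro σ i
    have hcont : Continuous (fun r : ℕ → Fin n => (σ ∘ r : ℕ → M)) :=
      continuous_pi fun j => (continuous_of_discreteTopology (f := σ)).comp (continuous_apply j)
    have : {r | c r σ = some i} = (fun r : ℕ → Fin n => (σ ∘ r : ℕ → M)) ⁻¹'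
        (Subtype.val '' (χ ⁻¹' {i})) := by
      ext r
      by_cases h : IsOmegaNESurj (σ ∘ r)
      · simp [c, h]
      · simp [c, h]
    rw [this]
    letI : MeasurableSpace (ℕ → M) := borel _
    haveI : BorelSpace (ℕ → M) := ⟨rfl⟩
    exact hcont.measurable (hχ i)
  have hopt : ∀ (σ : Fin n ≃ M) (o : Option (Fin k)), MeasurableSet {r | c r σ = o} := by
    intro σ o
    cases o with
    | some i => exact hsome σ i
    | none =>
      have : {r | c r σ = none} = (⋃ i, {r | c r σ = some i})ᶜ := by
        ext r
        rcases h : c r σ with _ | i <;> simp [h]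
      rw [this]
      exact (MeasurableSet.iUnion fun i => hsome σ i).compl
  have hc : ∀ q, MeasurableSet (c ⁻¹' {q}) := by
    intro q
    have : c ⁻¹' {q} = ⋂ σ, {r | c r σ = q σ} := by
      ext r
      simp [funext_iff]
    rw [this]
    exact MeasurableSet.iInter fun σ => hopt σ (q σ)
  obtain ⟨w, hw, q, hq⟩ := QQ_one n hn1 _ c hc
  refine ⟨w, ⟨hw.2.1, fun x y _ => max_le_max (hw.1.le x) (hw.1.le y)⟩, ?_⟩
  have hsub : (some '' {c : Fin k | ∃ g : {f : ℕ → M // IsOmegaNESurj f},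
          (∃ f : ℕ → M, IsOmegaNESurj f ∧ g.1 = f ∘ w) ∧ χ g = c}) ⊆ q '' Set.univ := by
    rintro _ ⟨i, ⟨⟨g, hg⟩, ⟨f, hf, hgf⟩, hi⟩, rfl⟩
    obtain ⟨σ, r, hr, hfr⟩ := exists_order hn hn1 f hf.1
    refine ⟨σ, trivial, ?_⟩
    rw [← hq r hr]
    have hgr : g = σ ∘ (r ∘ w) := by
      simp only at hgf
      rw [hgf, hfr]; rfl
    subst hgr
    simp only [c, dif_pos hg, hi]
  rw [← Set.ncard_image_of_injective _ (Option.some_injective (Fin k))]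
  calc _ ≤ (q '' Set.univ).ncard := Set.ncard_le_ncard hsub (Set.toFinite _)
    _ ≤ (Set.univ : Set (Fin n ≃ M)).ncard := Set.ncard_image_le (Set.toFinite _)
    _ = Nat.factorial n := by
      rw [Set.ncard_univ, Nat.card_eq_fintype_card,
        Fintype.card_equiv (Fintype.equivFinOfCardEq hn).symm, Fintype.card_fin]
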